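/- Fix η ∈ (0,1), ε > 0, D ≥ 1, and channels W₁, …, W_D from 𝒳 to finite output alphabets 𝒴₁, …, 𝒴_D. Then for all sufficiently large n and every nonempty A ⊆ 𝒳ⁿ, there exists a nonempty A′ ⊆ A such that: (1) 0 ≤ (1/n)·log₂|A| − (1/n)·log₂|A′| ≤ ε; (2) when Xⁿ is uniformly distributed on A, the conditional entropy of Xⁿ given Xⁿ ∈ A′ equals log₂|A′|; and (3) for every i ∈ [1,D], |(1/n)·H(P^{(i)}_{A′}) − (1/n)·log₂ g^n_i(A′, η)| ≤ ε. -/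

import Mathlib

open scoped BigOperators Classical
open Finset Real

noncomputable section

/-- The `n`-fold product channel: `Wⁿ(yⁿ|xⁿ) = ∏ⱼ W(yⱼ|xⱼ)`. -/
def prodW {X Y : Type*} (W : X → Y → ℝ) {n : ℕ} (x : Fin n → X) (y : Fin n → Y) : ℝ :=
  ∏ j, W (x j) (y j)

/-- Probability `Wⁿ(B|xⁿ)` of an output set `B` given input `xⁿ`. -/
def prodWSet {X Y : Type*} (W : X → Y → ℝ) {n : ℕ} (x : Fin n → X)
    (B : Finset (Fin n → Y)) : ℝ :=
  ∑ y ∈ B, prodW W x y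

/-- Output distribution `P_A` of `Wⁿ` with uniformly distributed input on `A`. -/
def outDist {X Y : Type*} (W : X → Y → ℝ) {n : ℕ}
    (A : Finset (Fin n → X)) (y : Fin n → Y) : ℝ :=
  (A.card : ℝ)⁻¹ * ∑ x ∈ A, prodW W x y

/-- `W` is a channel: each row is a probability distribution on `Y`. -/
def isChannel {X Y : Type*} [Fintype Y] (W : X → Y → ℝ) : Prop :=
  ∀ x, (∀ y, 0 ≤ W x y) ∧ ∑ y, W x y = 1

/-- `K_δ = ⌈(log₂ |𝒴|)/δ⌉`. -/
def Kdel (c : ℕ) (δ : ℝ) : ℕ := ⌈Real.logb 2 c / δ⌉₊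

/-- The sets `B_k` of the `δ`-information-spectrum partition of `𝒴ⁿ` w.r.t. the
information spectrum `i_n(yⁿ) = -(1/n) log₂ p(yⁿ)`:  membership `kδ ≤ i_n(yⁿ) < (k+1)δ`
(resp. `Kδ ≤ i_n(yⁿ) < ∞` for `k = K`) is expressed directly in terms of `p`. -/
def specSet {Y : Type*} [Fintype Y] {n : ℕ} (p : (Fin n → Y) → ℝ)
    (δ : ℝ) (K k : ℕ) : Finset (Fin n → Y) :=
  if k < K then
    Finset.univ.filter fun y =>
      (2:ℝ) ^ (-((n:ℝ) * ((k:ℝ)+1) * δ)) < p y ∧ p y ≤ (2:ℝ) ^ (-((n:ℝ) * (k:ℝ) * δ))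
  else
    Finset.univ.filter fun y => 0 < p y ∧ p y ≤ (2:ℝ) ^ (-((n:ℝ) * (K:ℝ) * δ))

/-- `ḡⁿ(A,η)`: minimum cardinality of an `η`-quasi-image of `A` over `Wⁿ`. -/
def gbar {X Y : Type*} [Fintype Y] (W : X → Y → ℝ) {n : ℕ}
    (A : Finset (Fin n → X)) (η : ℝ) : ℕ :=
  sInf {m | ∃ B : Finset (Fin n → Y), B.card = m ∧ η ≤ ∑ y ∈ B, outDist W A y}

/-- `gⁿ(A,η)`: minimum cardinality of an `η`-image of `A` over `Wⁿ`. -/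
def gimg {X Y : Type*} [Fintype Y] (W : X → Y → ℝ) {n : ℕ}
    (A : Finset (Fin n → X)) (η : ℝ) : ℕ :=
  sInf {m | ∃ B : Finset (Fin n → Y), B.card = m ∧ ∀ x ∈ A, η ≤ prodWSet W x B}

/-- Shannon entropy (base 2) of a distribution `q` on a finite set. -/
def ent {Z : Type*} [Fintype Z] (q : Z → ℝ) : ℝ :=
  -∑ z, q z * Real.logb 2 (q z)

end

/-- The conditional distribution of `Xⁿ` (uniform on `A`) given `Xⁿ ∈ A'` for `A' ⊆ A`:
the uniform distribution on `A'`. -/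
noncomputable def condUnif {X : Type*} [Fintype X] {n : ℕ} (A' : Finset (Fin n → X)) :
    (Fin n → X) → ℝ :=
  fun x => if x ∈ A' then ((A'.card : ℝ))⁻¹ else 0

section ProductMeasures

variable {Y : Type*} [Fintype Y]

lemma sum_prod_apply_eq_one {n : ℕ} {q : Fin n → Y → ℝ} (hq1 : ∀ j, ∑ b, q j b = 1) :
    ∑ y : Fin n → Y, ∏ j, q j (y j) = 1 := by
  have h := Finset.prod_univ_sum (fun _ : Fin n => (Finset.univ : Finset Y)) q
  rw [Fintype.piFinset_univ] at h
  rw [← h]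
  simp [hq1]

lemma sum_fin_succ_fun {n : ℕ} (F : (Fin (n + 1) → Y) → ℝ) :
    ∑ y, F y = ∑ a, ∑ y : Fin n → Y, F (Fin.cons a y) := by
  rw [← (Fin.consEquiv (fun _ : Fin (n + 1) => Y)).sum_comp, Fintype.sum_prod_type]
  rfl

lemma sum_mul_sq_le_of_abs_sub_le {q g : Y → ℝ} (hq0 : ∀ b, 0 ≤ q b) (hq1 : ∑ b, q b = 1)
    (hg : ∀ a b, |g a - g b| ≤ 1) :
    ∑ b, q b * g b ^ 2 ≤ (∑ b, q b * g b) ^ 2 + 1 := by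
  set m := ∑ b, q b * g b with hm
  have hdev : ∀ a, |g a - m| ≤ 1 := by
    intro a
    have h : g a - m = ∑ b, q b * (g a - g b) := by
      simp only [mul_sub, Finset.sum_sub_distrib, ← Finset.sum_mul, hq1, one_mul, hm]
    rw [h]
    calc |∑ b, q b * (g a - g b)| ≤ ∑ b, |q b * (g a - g b)| := Finset.abs_sum_le_sum_abs _ _
      _ ≤ ∑ b, q b := Finset.sum_le_sum fun b _ => by
          rw [abs_mul, abs_of_nonneg (hq0 b)]
          exact mul_le_of_le_one_right (hq0 b) (hg a b)
      _ = 1 := hq1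
  have hvar : ∑ b, q b * (g b - m) ^ 2 = ∑ b, q b * g b ^ 2 - m ^ 2 := by
    have h : ∀ b, q b * (g b - m) ^ 2 = q b * g b ^ 2 - 2 * m * (q b * g b) + m ^ 2 * q b :=
      fun b => by ring
    simp only [h, Finset.sum_add_distrib, Finset.sum_sub_distrib, ← Finset.mul_sum, hq1, ← hm]
    ring
  have hle : ∑ b, q b * (g b - m) ^ 2 ≤ 1 := by
    rw [← hq1]
    exact Finset.sum_le_sum fun b _ =>
      mul_le_of_le_one_right (hq0 b) ((sq_le_one_iff_abs_le_one _).2 (hdev b))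
  linarith

lemma sum_prod_mul_sq_le {n : ℕ} {q : Fin n → Y → ℝ} (hq0 : ∀ j b, 0 ≤ q j b)
    (hq1 : ∀ j, ∑ b, q j b = 1) {f : (Fin n → Y) → ℝ}
    (hf : ∀ y j b, |f (Function.update y j b) - f y| ≤ 1) :
    ∑ y, (∏ j, q j (y j)) * f y ^ 2 ≤ (∑ y, (∏ j, q j (y j)) * f y) ^ 2 + n := by
  induction n with
  | zero => simp
  | succ n ih =>
    set Q : (Fin n → Y) → ℝ := fun y => ∏ j, q j.succ (y j) with hQ
    have hQ0 : ∀ y, 0 ≤ Q y := fun y => Finset.prod_nonneg fun j _ => hq0 _ _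
    have hQ1 : ∑ y, Q y = 1 := sum_prod_apply_eq_one fun j => hq1 j.succ
    set g : Y → ℝ := fun a => ∑ y : Fin n → Y, Q y * f (Fin.cons a y) with hg
    have hsec : ∀ a, ∑ y : Fin n → Y, Q y * f (Fin.cons a y) ^ 2 ≤ g a ^ 2 + n := by
      intro a
      refine ih (q := fun j => q j.succ) (fun j => hq0 j.succ) (fun j => hq1 j.succ)
        (f := fun y => f (Fin.cons a y)) fun y j b => ?_
      have h := hf (Fin.cons a y) j.succ b
      rwa [← Fin.cons_update] at h
    have hosc : ∀ a b, |g a - g b| ≤ 1 := by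
      intro a b
      have h : g a - g b = ∑ y, Q y * (f (Fin.cons a y) - f (Fin.cons b y)) := by
        simp only [hg, mul_sub, Finset.sum_sub_distrib]
      rw [h, ← hQ1]
      refine (Finset.abs_sum_le_sum_abs _ _).trans (Finset.sum_le_sum fun y _ => ?_)
      rw [abs_mul, abs_of_nonneg (hQ0 y)]
      refine mul_le_of_le_one_right (hQ0 y) ?_
      have h := hf (Fin.cons b y) 0 a
      rwa [Fin.update_cons_zero] at h
    have hone := sum_mul_sq_le_of_abs_sub_le (hq0 0) (hq1 0) hosc
    have hfact : ∀ F : (Fin (n + 1) → Y) → ℝ, ∑ y, (∏ j, q j (y j)) * F y =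
        ∑ a, q 0 a * ∑ y : Fin n → Y, Q y * F (Fin.cons a y) := by
      intro F
      rw [sum_fin_succ_fun]
      refine Finset.sum_congr rfl fun a _ => ?_
      rw [Finset.mul_sum]
      refine Finset.sum_congr rfl fun y _ => ?_
      simp [Fin.prod_univ_succ, hQ, mul_assoc]
    rw [hfact (fun y => f y ^ 2), hfact f]
    calc ∑ a, q 0 a * ∑ y : Fin n → Y, Q y * f (Fin.cons a y) ^ 2
        ≤ ∑ a, q 0 a * (g a ^ 2 + n) :=
          Finset.sum_le_sum fun a _ => mul_le_mul_of_nonneg_left (hsec a) (hq0 0 a)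
      _ = ∑ a, q 0 a * g a ^ 2 + n := by
          simp only [mul_add, Finset.sum_add_distrib, ← Finset.sum_mul, hq1, one_mul]
      _ ≤ (∑ a, q 0 a * g a) ^ 2 + ((n + 1 : ℕ) : ℝ) := by push_cast; linarith

end ProductMeasures

section Channel

variable {X Y : Type*} [Fintype Y] {W : X → Y → ℝ} {n : ℕ}

lemma prodW_nonneg (hW : isChannel W) (x : Fin n → X) (y : Fin n → Y) : 0 ≤ prodW W x y :=
  Finset.prod_nonneg fun j _ => (hW (x j)).1 (y j)

lemma sum_prodW (hW : isChannel W) (x : Fin n → X) : ∑ y, prodW W x y = 1 :=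
  sum_prod_apply_eq_one fun j => (hW (x j)).2

lemma prodWSet_mono (hW : isChannel W) (x : Fin n → X) {B C : Finset (Fin n → Y)} (h : B ⊆ C) :
    prodWSet W x B ≤ prodWSet W x C :=
  Finset.sum_le_sum_of_subset_of_nonneg h fun y _ _ => prodW_nonneg hW x y

lemma prodWSet_nonneg (hW : isChannel W) (x : Fin n → X) (B : Finset (Fin n → Y)) :
    0 ≤ prodWSet W x B :=
  Finset.sum_nonneg fun y _ => prodW_nonneg hW x y

lemma prodWSet_le_one (hW : isChannel W) (x : Fin n → X) (B : Finset (Fin n → Y)) :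
    prodWSet W x B ≤ 1 :=
  (prodWSet_mono hW x (Finset.subset_univ B)).trans_eq (sum_prodW hW x)

lemma add_sub_one_le_prodWSet_inter (hW : isChannel W) (x : Fin n → X)
    (B C : Finset (Fin n → Y)) :
    prodWSet W x B + prodWSet W x C - 1 ≤ prodWSet W x (B ∩ C) := by
  have h : prodWSet W x (B ∪ C) + prodWSet W x (B ∩ C) = prodWSet W x B + prodWSet W x C :=
    Finset.sum_union_inter
  linarith [prodWSet_le_one hW x (B ∪ C)]

/-- The words within Hamming distance `r` of `B`. -/
noncomputable def hammingNhd (B : Finset (Fin n → Y)) (r : ℝ) : Finset (Fin n → Y) :=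
  Finset.univ.filter fun y => ∃ b ∈ B, (hammingDist y b : ℝ) ≤ r

lemma sum_pow_hammingDist_le {a : ℝ} (ha : 0 ≤ a) (b : Fin n → Y) :
    ∑ y, a ^ hammingDist y b ≤ (1 + Fintype.card Y * a) ^ n := by
  have h1 : ∀ y : Fin n → Y, a ^ hammingDist y b = ∏ j, if y j = b j then 1 else a := by
    intro y
    rw [Finset.prod_ite, Finset.prod_const_one, one_mul, Finset.prod_const]
    rfl
  have h2 := Finset.prod_univ_sum (fun _ : Fin n => (Finset.univ : Finset Y))
    (fun j u => if u = b j then (1 : ℝ) else a)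
  rw [Fintype.piFinset_univ] at h2
  simp only [h1]
  rw [← h2]
  calc ∏ j, ∑ u, (if u = b j then (1 : ℝ) else a) ≤ ∏ _j : Fin n, (1 + Fintype.card Y * a) := by
        refine Finset.prod_le_prod
          (fun j _ => Finset.sum_nonneg fun u _ => by split_ifs <;> positivity) fun j _ => ?_
        calc ∑ u, (if u = b j then (1 : ℝ) else a)
            ≤ ∑ u, ((if u = b j then (1 : ℝ) else 0) + a) :=
              Finset.sum_le_sum fun u _ => by split_ifs <;> linarith
          _ = 1 + Fintype.card Y * a := by simp [Finset.sum_add_distrib]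
    _ = (1 + Fintype.card Y * a) ^ n := by simp

lemma card_hammingNhd_mul_le {a : ℝ} (ha : 0 < a) (ha1 : a ≤ 1) (B : Finset (Fin n → Y)) (r : ℝ) :
    ((hammingNhd B r).card : ℝ) * a ^ r ≤ B.card * (1 + Fintype.card Y * a) ^ n := by
  calc ((hammingNhd B r).card : ℝ) * a ^ r
      = ∑ y ∈ hammingNhd B r, a ^ r := by simp
    _ ≤ ∑ y ∈ hammingNhd B r, ∑ b ∈ B, a ^ hammingDist y b := by
        refine Finset.sum_le_sum fun y hy => ?_
        obtain ⟨b, hb, hyb⟩ := (Finset.mem_filter.1 hy).2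
        calc a ^ r ≤ a ^ ((hammingDist y b : ℕ) : ℝ) :=
              Real.rpow_le_rpow_of_exponent_ge ha ha1 hyb
          _ = a ^ hammingDist y b := Real.rpow_natCast _ _
          _ ≤ ∑ b ∈ B, a ^ hammingDist y b :=
              Finset.single_le_sum (f := fun b => a ^ hammingDist y b)
                (fun c _ => by positivity) hb
    _ ≤ ∑ y, ∑ b ∈ B, a ^ hammingDist y b :=
        Finset.sum_le_sum_of_subset_of_nonneg (Finset.subset_univ _)
          fun y _ _ => Finset.sum_nonneg fun b _ => by positivity
    _ = ∑ b ∈ B, ∑ y, a ^ hammingDist y b := Finset.sum_comm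
    _ ≤ ∑ b ∈ B, (1 + Fintype.card Y * a) ^ n :=
        Finset.sum_le_sum fun b _ => sum_pow_hammingDist_le ha.le b
    _ = B.card * (1 + Fintype.card Y * a) ^ n := by simp

variable (Y) in
lemma exists_card_hammingNhd_le {δ : ℝ} (hδ : 0 < δ) :
    ∃ γ : ℝ, 0 < γ ∧ ∀ (n : ℕ) (B : Finset (Fin n → Y)),
      ((hammingNhd B (γ * n)).card : ℝ) ≤ 2 ^ (n * δ) * B.card := by
  set s : ℝ := 2 ^ (δ / 2) with hs
  have hs1 : 1 < s := Real.one_lt_rpow (by norm_num) (by positivity)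
  have hden : 0 < Fintype.card Y + s := by positivity
  set a : ℝ := (s - 1) / (Fintype.card Y + s) with ha
  have ha0 : 0 < a := div_pos (by linarith) hden
  have ha1 : a < 1 := by
    rw [ha, div_lt_one hden]
    have : (0 : ℝ) ≤ Fintype.card Y := by positivity
    linarith
  have hYa : 1 + Fintype.card Y * a ≤ s := by
    have h : a * (Fintype.card Y + s) = s - 1 := div_mul_cancel₀ _ hden.ne'
    nlinarith
  have hlog : Real.logb 2 a < 0 := Real.logb_neg (by norm_num) ha0 ha1
  refine ⟨δ / 2 / (-Real.logb 2 a), div_pos (by positivity) (by linarith), fun n B => ?_⟩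
  set γ := δ / 2 / (-Real.logb 2 a) with hγ
  have hpow : a ^ (γ * n) = (2 : ℝ) ^ (-(n * (δ / 2))) := by
    conv_lhs => rw [← Real.rpow_logb (b := 2) (by norm_num) (by norm_num) ha0]
    rw [← Real.rpow_mul (by norm_num)]
    congr 1
    have hlog0 := hlog.ne
    rw [hγ]
    field_simp
  have hcard := card_hammingNhd_mul_le ha0 ha1.le B (γ * n)
  have hsn : (1 + Fintype.card Y * a) ^ n ≤ (2 : ℝ) ^ (n * (δ / 2)) := by
    calc (1 + Fintype.card Y * a) ^ n ≤ s ^ n := pow_le_pow_left₀ (by positivity) hYa n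
      _ = (2 : ℝ) ^ (n * (δ / 2)) := by
          rw [hs, ← Real.rpow_natCast, ← Real.rpow_mul (by norm_num), mul_comm]
  rw [hpow, Real.rpow_neg (by norm_num), ← div_eq_mul_inv, div_le_iff₀ (by positivity)] at hcard
  calc ((hammingNhd B (γ * n)).card : ℝ)
      ≤ B.card * (1 + Fintype.card Y * a) ^ n * 2 ^ (n * (δ / 2)) := hcard
    _ ≤ B.card * 2 ^ (n * (δ / 2)) * 2 ^ (n * (δ / 2)) := by gcongr
    _ = 2 ^ (n * δ) * B.card := by
        rw [mul_assoc, ← Real.rpow_add (by norm_num), mul_comm]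
        congr 2
        ring

/-- Blowing-up lemma with a Chebyshev-type rate. -/
lemma one_sub_le_prodWSet_hammingNhd (hW : isChannel W) (x : Fin n → X)
    {B : Finset (Fin n → Y)} {c τ r : ℝ} (hc : 0 < c) (hr : 0 < r)
    (hrc : 4 * n ≤ c * r ^ 2) (hrτ : 4 * n ≤ τ * r ^ 2) (hB : c ≤ prodWSet W x B) :
    1 - τ ≤ prodWSet W x (hammingNhd B r) := by
  have hne : B.Nonempty := by
    rw [Finset.nonempty_iff_ne_empty]
    rintro rfl
    simp only [prodWSet, Finset.sum_empty] at hB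
    linarith
  set f : (Fin n → Y) → ℝ := fun y => ((B.inf' hne fun b => hammingDist y b : ℕ) : ℝ) with hf
  have hlip : ∀ y z, f y ≤ hammingDist y z + f z := by
    intro y z
    obtain ⟨b, hb, hzb⟩ := Finset.exists_mem_eq_inf' hne fun b => hammingDist z b
    simp only [hf, hzb]
    exact_mod_cast (Finset.inf'_le _ hb).trans (hammingDist_triangle y z b)
  have hupd : ∀ (y : Fin n → Y) j b, hammingDist (Function.update y j b) y ≤ 1 := by
    intro y j b
    refine (Finset.card_le_card (t := {j}) fun i hi => ?_).trans_eq (Finset.card_singleton j)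
    by_contra hij
    simp [Function.update_of_ne (Finset.notMem_singleton.1 hij)] at hi
  have hf1 : ∀ y j b, |f (Function.update y j b) - f y| ≤ 1 := by
    intro y j b
    have h1 := hlip (Function.update y j b) y
    have h2 := hlip y (Function.update y j b)
    rw [hammingDist_comm] at h2
    have h3 : (hammingDist (Function.update y j b) y : ℝ) ≤ 1 := by exact_mod_cast hupd y j b
    rw [abs_le]
    constructor <;> linarith
  have hvar := sum_prod_mul_sq_le (fun j => (hW (x j)).1) (fun j => (hW (x j)).2) hf1
  change ∑ y, prodW W x y * f y ^ 2 ≤ (∑ y, prodW W x y * f y) ^ 2 + n at hvar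
  set m := ∑ y, prodW W x y * f y with hm
  have hdev : ∑ y, prodW W x y * (f y - m) ^ 2 ≤ n := by
    have h : ∀ y, prodW W x y * (f y - m) ^ 2 =
        prodW W x y * f y ^ 2 - 2 * m * (prodW W x y * f y) + m ^ 2 * prodW W x y :=
      fun y => by ring
    simp only [h, Finset.sum_add_distrib, Finset.sum_sub_distrib, ← Finset.mul_sum,
      sum_prodW hW, ← hm]
    nlinarith
  have hcheb : ∀ (C : Finset (Fin n → Y)) (t : ℝ), (∀ y ∈ C, t ≤ (f y - m) ^ 2) →
      prodWSet W x C * t ≤ n := by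
    intro C t hC
    refine le_trans ?_ hdev
    rw [prodWSet, Finset.sum_mul]
    refine (Finset.sum_le_sum fun y hy =>
      mul_le_mul_of_nonneg_left (hC y hy) (prodW_nonneg hW x y)).trans ?_
    exact Finset.sum_le_sum_of_subset_of_nonneg (Finset.subset_univ _)
      fun y _ _ => mul_nonneg (prodW_nonneg hW x y) (sq_nonneg _)
  have hm0 : 0 ≤ m := Finset.sum_nonneg fun y _ => mul_nonneg (prodW_nonneg hW x y) (by positivity)
  have hmr : m ≤ r / 2 := by
    have h := hcheb B (m ^ 2) fun y hy => by
      have : f y = 0 := by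
        have : (B.inf' hne fun b => hammingDist y b) ≤ hammingDist y y := Finset.inf'_le _ hy
        exact Nat.cast_eq_zero.2 (Nat.le_zero.1 (by rwa [hammingDist_self] at this))
      simp [this]
    have h2 : c * m ^ 2 ≤ c * (r / 2) ^ 2 := by
      have := mul_le_mul_of_nonneg_right hB (sq_nonneg m)
      linarith
    exact (sq_le_sq₀ hm0 (by positivity)).1 (le_of_mul_le_mul_left h2 hc)
  have hcompl : prodWSet W x (hammingNhd B r)ᶜ ≤ τ := by
    have h := hcheb (hammingNhd B r)ᶜ ((r / 2) ^ 2) fun y hy => by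
      have hfy : r < f y := by
        by_contra hle
        obtain ⟨b, hb, hyb⟩ := Finset.exists_mem_eq_inf' hne fun b => hammingDist y b
        refine Finset.mem_compl.1 hy (Finset.mem_filter.2 ⟨Finset.mem_univ _, b, hb, ?_⟩)
        rw [← hyb]
        exact not_lt.1 hle
      exact pow_le_pow_left₀ (by positivity) (by linarith) 2
    have h2 : prodWSet W x (hammingNhd B r)ᶜ * (r / 2) ^ 2 ≤ τ * (r / 2) ^ 2 := by linarith
    exact le_of_mul_le_mul_right h2 (by positivity)
  have htot : prodWSet W x (hammingNhd B r) + prodWSet W x (hammingNhd B r)ᶜ = 1 := by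
    rw [prodWSet, prodWSet, Finset.sum_add_sum_compl, sum_prodW hW]
  linarith

/-- Blowing-up lemma: enlarging a set by a subexponential factor raises its probability from `c`
to `1 - τ`, simultaneously for all inputs. -/
lemma eventually_exists_blowup (hW : isChannel W) {c τ δ : ℝ} (hc : 0 < c) (hτ : 0 < τ)
    (hδ : 0 < δ) :
    ∀ᶠ n : ℕ in Filter.atTop, ∀ B : Finset (Fin n → Y), ∃ B' : Finset (Fin n → Y),
      (B'.card : ℝ) ≤ 2 ^ (n * δ) * B.card ∧
        ∀ x : Fin n → X, c ≤ prodWSet W x B → 1 - τ ≤ prodWSet W x B' := by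
  obtain ⟨γ, hγ, hcard⟩ := exists_card_hammingNhd_le Y hδ
  have hlarge : ∀ t : ℝ, 0 < t → ∀ᶠ n : ℕ in Filter.atTop, 4 * (n : ℝ) ≤ t * (γ * n) ^ 2 := by
    intro t ht
    filter_upwards [tendsto_natCast_atTop_atTop.eventually_ge_atTop (4 / (t * γ ^ 2))] with n hn
    rw [div_le_iff₀ (by positivity)] at hn
    nlinarith [(Nat.cast_nonneg n : (0 : ℝ) ≤ n)]
  filter_upwards [hlarge c hc, hlarge τ hτ, Filter.eventually_ge_atTop 1] with n h1 h2 hn B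
  have hn0 : (0 : ℝ) < n := by exact_mod_cast hn
  exact ⟨_, hcard n B, fun x hx =>
    one_sub_le_prodWSet_hammingNhd hW x hc (by positivity) h1 h2 hx⟩

end Channel

section Entropy

variable {Z : Type*} [Fintype Z] {p : Z → ℝ}

lemma mul_le_ent (hp0 : ∀ z, 0 ≤ p z) (hp1 : ∑ z, p z = 1) {S : Finset Z} {τ h : ℝ} (hh : 0 ≤ h)
    (hS : ∀ z ∉ S, p z ≤ 2 ^ (-h)) (hτ : ∑ z ∈ S, p z ≤ τ) : (1 - τ) * h ≤ ent p := by
  have hple : ∀ z, p z ≤ 1 := fun z =>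
    (Finset.single_le_sum (fun w _ => hp0 w) (Finset.mem_univ z)).trans_eq hp1
  have hcompl : 1 - τ ≤ ∑ z ∈ Sᶜ, p z := by
    have := Finset.sum_add_sum_compl S p
    linarith
  rw [ent, ← Finset.sum_neg_distrib]
  calc (1 - τ) * h ≤ (∑ z ∈ Sᶜ, p z) * h := mul_le_mul_of_nonneg_right hcompl hh
    _ = ∑ z ∈ Sᶜ, p z * h := Finset.sum_mul _ _ _
    _ ≤ ∑ z ∈ Sᶜ, -(p z * logb 2 (p z)) := by
        refine Finset.sum_le_sum fun z hz => ?_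
        rcases (hp0 z).eq_or_lt with h0 | h0
        · simp [← h0]
        · have hlog : logb 2 (p z) ≤ -h :=
            (Real.logb_le_iff_le_rpow (by norm_num) h0).2 (hS z (Finset.mem_compl.1 hz))
          nlinarith
    _ ≤ ∑ z, -(p z * logb 2 (p z)) := by
        refine Finset.sum_le_sum_of_subset_of_nonneg (Finset.subset_univ _) fun z _ _ => ?_
        have := mul_nonpos_of_nonneg_of_nonpos (hp0 z)
          (Real.logb_nonpos (b := 2) (by norm_num) (hp0 z) (hple z))
        linarith

lemma ent_nonneg (hp0 : ∀ z, 0 ≤ p z) (hp1 : ∑ z, p z = 1) : 0 ≤ ent p := by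
  have h := mul_le_ent hp0 hp1 (S := Finset.univ) (τ := 1) le_rfl (by simp) hp1.le
  simpa using h

/-- The Gibbs inequality. -/
lemma ent_le_neg_sum_mul_logb (hp0 : ∀ z, 0 ≤ p z) (hp1 : ∑ z, p z = 1) {q : Z → ℝ}
    (hq0 : ∀ z, 0 < q z) (hq1 : ∑ z, q z ≤ 1) : ent p ≤ -∑ z, p z * logb 2 (q z) := by
  have hlog2 : 0 < Real.log 2 := Real.log_pos (by norm_num)
  have hterm : ∀ z, p z * logb 2 (q z) - p z * logb 2 (p z) ≤ (q z - p z) / Real.log 2 := by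
    intro z
    rcases (hp0 z).eq_or_lt with h0 | h0
    · simp only [← h0, zero_mul, sub_zero]
      exact div_nonneg (hq0 z).le hlog2.le
    · have h := Real.log_le_sub_one_of_pos (div_pos (hq0 z) h0)
      rw [Real.log_div (hq0 z).ne' h0.ne'] at h
      rw [Real.logb, Real.logb, ← mul_sub, ← sub_div, ← mul_div_assoc]
      refine div_le_div_of_nonneg_right ?_ hlog2.le
      calc p z * (Real.log (q z) - Real.log (p z)) ≤ p z * (q z / p z - 1) :=
            mul_le_mul_of_nonneg_left h h0.le
        _ = q z - p z := by field_simp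
  have hsum := Finset.sum_le_sum fun z (_ : z ∈ Finset.univ) => hterm z
  rw [Finset.sum_sub_distrib, ← Finset.sum_div, Finset.sum_sub_distrib, hp1] at hsum
  have hle : (∑ z, q z - 1) / Real.log 2 ≤ 0 :=
    div_nonpos_of_nonpos_of_nonneg (by linarith) hlog2.le
  rw [ent]
  linarith

lemma ent_le_of_card_le [Nonempty Z] (hp0 : ∀ z, 0 ≤ p z) (hp1 : ∑ z, p z = 1) {B : Finset Z}
    {τ L : ℝ} (hL : 0 ≤ L) (hB : (B.card : ℝ) ≤ 2 ^ L) (hτ : 1 - τ ≤ ∑ z ∈ B, p z) :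
    ent p ≤ 1 + L + τ * logb 2 (Fintype.card Z) := by
  set m : ℝ := (Fintype.card Z : ℝ) with hm
  have hm1 : 1 ≤ m := Nat.one_le_cast.2 Fintype.card_pos
  have hm0 : 0 < m := by linarith
  have hlogm : 0 ≤ logb 2 m := Real.logb_nonneg (by norm_num) hm1
  set q : Z → ℝ := fun z => 2⁻¹ * ((if z ∈ B then 2 ^ (-L) else 0) + m⁻¹) with hq
  have hite : ∀ z, (0 : ℝ) ≤ if z ∈ B then 2 ^ (-L) else 0 := fun z => by
    split_ifs <;> positivity
  have hminv : 0 < m⁻¹ := inv_pos.2 hm0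
  have hq0 : ∀ z, 0 < q z := fun z => by
    have := hite z
    positivity
  have hq1 : ∑ z, q z ≤ 1 := by
    have h1 : (B.card : ℝ) * 2 ^ (-L) ≤ 1 := by
      rw [Real.rpow_neg (by norm_num), ← div_eq_mul_inv]
      exact div_le_one_of_le₀ hB (by positivity)
    rw [← Finset.mul_sum, Finset.sum_add_distrib, Finset.sum_ite_mem, Finset.univ_inter]
    simp only [Finset.sum_const, nsmul_eq_mul, Finset.card_univ, ← hm, mul_inv_cancel₀ hm0.ne']
    linarith
  have hcompl : ∑ z ∈ Bᶜ, p z ≤ τ := by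
    have := Finset.sum_add_sum_compl B p
    linarith
  have hcompl0 : 0 ≤ ∑ z ∈ Bᶜ, p z := Finset.sum_nonneg fun z _ => hp0 z
  have hlogq : ∀ z t, 2 ^ (-t) ≤ 2 * q z → -(1 + t) ≤ logb 2 (q z) := by
    intro z t ht
    rw [Real.le_logb_iff_rpow_le (by norm_num) (hq0 z), neg_add, Real.rpow_add (by norm_num),
      Real.rpow_neg_one]
    linarith
  have hmem : ∀ z ∈ B, -(p z * logb 2 (q z)) ≤ p z * (1 + L) := by
    intro z hz
    have h := hlogq z L (by simp only [hq, if_pos hz]; linarith)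
    nlinarith [hp0 z]
  have hnmem : ∀ z ∈ Bᶜ, -(p z * logb 2 (q z)) ≤ p z * (1 + logb 2 m) := by
    intro z _
    have h := hlogq z (logb 2 m) (by
      rw [Real.rpow_neg (by norm_num), Real.rpow_logb (by norm_num) (by norm_num) hm0]
      have := hite z
      simp only [hq]
      linarith)
    nlinarith [hp0 z]
  calc ent p ≤ -∑ z, p z * logb 2 (q z) := ent_le_neg_sum_mul_logb hp0 hp1 hq0 hq1
    _ = ∑ z ∈ B, -(p z * logb 2 (q z)) + ∑ z ∈ Bᶜ, -(p z * logb 2 (q z)) := by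
        rw [← Finset.sum_neg_distrib, Finset.sum_add_sum_compl]
    _ ≤ ∑ z ∈ B, p z * (1 + L) + ∑ z ∈ Bᶜ, p z * (1 + logb 2 m) :=
        add_le_add (Finset.sum_le_sum hmem) (Finset.sum_le_sum hnmem)
    _ = (∑ z ∈ B, p z) * (1 + L) + (∑ z ∈ Bᶜ, p z) * (1 + logb 2 m) := by
        rw [Finset.sum_mul, Finset.sum_mul]
    _ ≤ 1 + L + τ * logb 2 m := by
        have htot := Finset.sum_add_sum_compl B p
        rw [hp1] at htot
        nlinarith

lemma ent_condUnif {X : Type*} [Fintype X] {n : ℕ} {A : Finset (Fin n → X)} (hA : A.Nonempty) :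
    ent (condUnif A) = logb 2 A.card := by
  have hcard : (A.card : ℝ) ≠ 0 := by exact_mod_cast hA.card_pos.ne'
  have h : ∀ x, condUnif A x * logb 2 (condUnif A x) =
      if x ∈ A then (A.card : ℝ)⁻¹ * logb 2 (A.card : ℝ)⁻¹ else 0 := fun x => by
    unfold condUnif
    split_ifs <;> simp
  simp only [ent, h]
  rw [Finset.sum_ite_mem, Finset.univ_inter, Finset.sum_const, nsmul_eq_mul, Real.logb_inv]
  field_simp

end Entropy

section ImageSize

lemma card_mul_sum_outDist {X Y : Type*} {W : X → Y → ℝ} {n : ℕ} {A : Finset (Fin n → X)}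
    (hA : A.Nonempty) (B : Finset (Fin n → Y)) :
    A.card * ∑ y ∈ B, outDist W A y = ∑ x ∈ A, prodWSet W x B := by
  have hcard : (A.card : ℝ) ≠ 0 := by exact_mod_cast hA.card_pos.ne'
  simp only [outDist, ← Finset.mul_sum, prodWSet]
  rw [mul_inv_cancel_left₀ hcard, Finset.sum_comm]

variable {X Y : Type*} [Fintype Y] {W : X → Y → ℝ} {n : ℕ}

lemma outDist_nonneg (hW : isChannel W) (A : Finset (Fin n → X)) (y : Fin n → Y) :
    0 ≤ outDist W A y :=
  mul_nonneg (by positivity) (Finset.sum_nonneg fun x _ => prodW_nonneg hW x y)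

lemma sum_outDist (hW : isChannel W) {A : Finset (Fin n → X)} (hA : A.Nonempty) :
    ∑ y, outDist W A y = 1 := by
  have hcard : (A.card : ℝ) ≠ 0 := by exact_mod_cast hA.card_pos.ne'
  have h := card_mul_sum_outDist (W := W) hA Finset.univ
  have h1 : ∀ x : Fin n → X, prodWSet W x Finset.univ = 1 := sum_prodW hW
  simp only [h1, Finset.sum_const, nsmul_eq_mul] at h
  exact mul_left_cancel₀ hcard h

lemma gimg_le_card {A : Finset (Fin n → X)} {η : ℝ} {B : Finset (Fin n → Y)}
    (hB : ∀ x ∈ A, η ≤ prodWSet W x B) : gimg W A η ≤ B.card :=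
  Nat.sInf_le ⟨B, rfl, hB⟩

lemma exists_card_eq_gimg (hW : isChannel W) (A : Finset (Fin n → X)) {η : ℝ} (hη : η ≤ 1) :
    ∃ B : Finset (Fin n → Y), B.card = gimg W A η ∧ ∀ x ∈ A, η ≤ prodWSet W x B :=
  Nat.sInf_mem (s := {m | ∃ B : Finset (Fin n → Y), B.card = m ∧ ∀ x ∈ A, η ≤ prodWSet W x B})
    ⟨_, Finset.univ, rfl, fun x _ => hη.trans_eq (sum_prodW hW x).symm⟩

lemma eventually_le_two_rpow_mul (t : ℝ) {δ : ℝ} (hδ : 0 < δ) :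
    ∀ᶠ n : ℕ in Filter.atTop, t ≤ (2 : ℝ) ^ (n * δ) := by
  have h1 : (1 : ℝ) < 2 ^ δ := Real.one_lt_rpow (by norm_num) hδ
  filter_upwards [(tendsto_pow_atTop_atTop_of_one_lt h1).eventually_ge_atTop t] with n hn
  rwa [mul_comm, Real.rpow_mul (by norm_num), Real.rpow_natCast]

lemma sum_prodWSet_le (hW : isChannel W) {A T : Finset (Fin n → X)} {S : Finset (Fin n → Y)}
    {v : ℝ} (hT : T.Nonempty) (hTA : T ⊆ A) (hS : ∀ y ∈ S, outDist W A y ≤ v) :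
    ∑ x ∈ T, prodWSet W x S ≤ A.card * (S.card * v) := by
  calc ∑ x ∈ T, prodWSet W x S ≤ ∑ x ∈ A, prodWSet W x S :=
        Finset.sum_le_sum_of_subset_of_nonneg hTA fun x _ _ => prodWSet_nonneg hW x S
    _ = A.card * ∑ y ∈ S, outDist W A y := (card_mul_sum_outDist (hT.mono hTA) S).symm
    _ ≤ A.card * (S.card * v) := by
        rw [← nsmul_eq_mul S.card v]
        exact mul_le_mul_of_nonneg_left (Finset.sum_le_card_nsmul _ _ _ hS) (by positivity)

/-- Suppose that a substantial part `T` of `A` sees a set `S`, on which the output distribution of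
`A` is at most `2 * 2 ^ (-h)`, with non-vanishing probability. Then every set with non-vanishing
probability under all inputs from `T` has, to first order, at least `2 ^ h` elements. -/
lemma eventually_two_rpow_le_mul_card (hW : isChannel W) {c c' θ δ : ℝ} (hc : 0 < c)
    (hc' : 0 < c') (hθ : 0 < θ) (hδ : 0 < δ) :
    ∀ᶠ n : ℕ in Filter.atTop, ∀ (A T : Finset (Fin n → X)) (S B : Finset (Fin n → Y)) (h : ℝ),
      T.Nonempty → T ⊆ A → θ * A.card ≤ T.card → (∀ y ∈ S, outDist W A y ≤ 2 * 2 ^ (-h)) →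
      (∀ x ∈ T, c ≤ prodWSet W x S) → (∀ x ∈ T, c' ≤ prodWSet W x B) →
      (2 : ℝ) ^ h ≤ 2 ^ (n * δ) * B.card := by
  filter_upwards [eventually_exists_blowup hW hc' (half_pos hc) (half_pos hδ),
    eventually_le_two_rpow_mul (4 / (c * θ)) (half_pos hδ)] with
    n hblow hn A T S B h hT hTA hcard hS hTS hTB
  obtain ⟨B', hB'card, hB'⟩ := hblow B
  have hA0 : (0 : ℝ) < A.card := by exact_mod_cast (hT.mono hTA).card_pos
  have hlow : T.card * (c / 2) ≤ ∑ x ∈ T, prodWSet W x (B' ∩ S) := by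
    rw [← nsmul_eq_mul]
    refine Finset.card_nsmul_le_sum _ _ _ fun x hx => ?_
    linarith [add_sub_one_le_prodWSet_inter hW x B' S, hB' x (hTB x hx), hTS x hx]
  have hup := sum_prodWSet_le hW hT hTA fun y (hy : y ∈ B' ∩ S) =>
    hS y (Finset.mem_of_mem_inter_right hy)
  have hinter : ((B' ∩ S).card : ℝ) ≤ B'.card := by
    exact_mod_cast Finset.card_le_card Finset.inter_subset_left
  have h2h : (0 : ℝ) < 2 ^ h := by positivity
  have hkey : θ * (c / 2) ≤ B'.card * (2 * 2 ^ (-h)) := by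
    refine le_of_mul_le_mul_left ?_ hA0
    calc A.card * (θ * (c / 2)) = θ * A.card * (c / 2) := by ring
      _ ≤ T.card * (c / 2) := by gcongr
      _ ≤ A.card * ((B' ∩ S).card * (2 * 2 ^ (-h))) := hlow.trans hup
      _ ≤ A.card * (B'.card * (2 * 2 ^ (-h))) := by gcongr
  rw [Real.rpow_neg (by norm_num), ← mul_assoc, ← div_eq_mul_inv, le_div_iff₀ h2h] at hkey
  calc (2 : ℝ) ^ h ≤ 4 / (c * θ) * B'.card := by
        rw [div_mul_eq_mul_div, le_div_iff₀ (by positivity)]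
        linarith
    _ ≤ 2 ^ (n * (δ / 2)) * (2 ^ (n * (δ / 2)) * B.card) := by gcongr
    _ = 2 ^ (n * δ) * B.card := by
        rw [← mul_assoc, ← Real.rpow_add (by norm_num)]
        congr 2
        ring

lemma le_card_filter_le_prodWSet (hW : isChannel W) {T : Finset (Fin n → X)} (hT : T.Nonempty)
    {S : Finset (Fin n → Y)} {τ : ℝ} (hτ : 0 ≤ τ) (hS : τ ≤ ∑ y ∈ S, outDist W T y) :
    τ / 2 * T.card ≤ (T.filter fun x => τ / 2 ≤ prodWSet W x S).card := by
  have h1 : T.card * τ ≤ ∑ x ∈ T, prodWSet W x S := by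
    rw [← card_mul_sum_outDist hT]
    gcongr
  have h2 : ∑ x ∈ T, prodWSet W x S ≤
      ∑ x ∈ T, ((if τ / 2 ≤ prodWSet W x S then (1 : ℝ) else 0) + τ / 2) := by
    refine Finset.sum_le_sum fun x _ => ?_
    split_ifs with hx
    · linarith [prodWSet_le_one hW x S]
    · linarith
  rw [Finset.sum_add_distrib, Finset.sum_boole, Finset.sum_const, nsmul_eq_mul] at h2
  linarith

/-- On a substantial part `T` of `A` which sees one slice `S` of the information spectrum of `A`
with non-vanishing probability, image size and output entropy agree to first order. -/
lemma eventually_abs_ent_sub_logb_gimg_le [Nonempty Y] (hW : isChannel W) {c θ δ M η : ℝ}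
    (hc : 0 < c) (hθ : 0 < θ) (hδ : 0 < δ) (hM : 0 < M) (hη : η ∈ Set.Ioo (0 : ℝ) 1) :
    ∀ᶠ n : ℕ in Filter.atTop, ∀ (A T : Finset (Fin n → X)) (S : Finset (Fin n → Y)) (h : ℝ),
      T.Nonempty → T ⊆ A → θ * A.card ≤ T.card → 0 ≤ h → h ≤ n * M →
      (∀ y ∈ S, outDist W A y ≤ 2 * 2 ^ (-h)) → (S.card : ℝ) ≤ 2 ^ (h + n * δ) →
      (∀ x ∈ T, c ≤ prodWSet W x S) →
      |ent (outDist W T) - logb 2 (gimg W T η)| ≤ 5 * (n * δ) := by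
  set ℓ : ℝ := logb 2 (Fintype.card Y) with hℓ
  have hℓ0 : 0 ≤ ℓ :=
    Real.logb_nonneg (by norm_num) (by exact_mod_cast Fintype.card_pos (α := Y))
  set τ : ℝ := δ / (ℓ + 1) with hτ
  have hτ0 : 0 < τ := by positivity
  have hτℓ : τ * ℓ ≤ δ := by
    rw [hτ, div_mul_eq_mul_div, div_le_iff₀ (by positivity)]
    nlinarith
  set σ : ℝ := δ / M with hσ
  have hσ0 : 0 < σ := by positivity
  have hσM : σ * M = δ := div_mul_cancel₀ _ hM.ne'
  filter_upwards [eventually_exists_blowup hW hc hτ0 hδ,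
    eventually_exists_blowup hW hc (sub_pos.2 hη.2) hδ,
    eventually_two_rpow_le_mul_card hW hc hη.1 hθ hδ,
    eventually_two_rpow_le_mul_card hW hc (half_pos hσ0) (mul_pos (half_pos hσ0) hθ) hδ,
    tendsto_natCast_atTop_atTop.eventually_ge_atTop (1 / δ), Filter.eventually_ge_atTop 1] with
    n hblowτ hblowη himg hsub hnδ hn A T S h hT hTA hcard hh0 hhM hSA hScard hTS
  have hn0 : (0 : ℝ) < n := by exact_mod_cast hn
  rw [div_le_iff₀ hδ] at hnδ
  have hp0 := outDist_nonneg hW T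
  have hp1 := sum_outDist hW hT
  have hcardle : ∀ B : Finset (Fin n → Y), (B.card : ℝ) ≤ 2 ^ (n * δ) * S.card →
      (B.card : ℝ) ≤ 2 ^ (h + 2 * (n * δ)) := fun B hB => by
    calc (B.card : ℝ) ≤ 2 ^ (n * δ) * 2 ^ (h + n * δ) := hB.trans (by gcongr)
      _ = 2 ^ (h + 2 * (n * δ)) := by
          rw [← Real.rpow_add (by norm_num)]
          congr 1
          ring
  have himg_lower : 0 < (gimg W T η : ℝ) ∧ h - n * δ ≤ logb 2 (gimg W T η) := by
    obtain ⟨B, hBcard, hB⟩ := exists_card_eq_gimg hW T hη.2.le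
    have hle := himg A T S B h hT hTA hcard hSA hTS hB
    rw [hBcard] at hle
    have hpos : 0 < (gimg W T η : ℝ) :=
      pos_of_mul_pos_right ((by positivity : (0 : ℝ) < 2 ^ h).trans_le hle) (by positivity)
    refine ⟨hpos, ?_⟩
    rw [Real.le_logb_iff_rpow_le (by norm_num) hpos, Real.rpow_sub (by norm_num),
      div_le_iff₀ (by positivity), mul_comm]
    exact hle
  have himg_upper : logb 2 (gimg W T η) ≤ h + 2 * (n * δ) := by
    obtain ⟨B, hBcard, hB⟩ := hblowη S
    rw [Real.logb_le_iff_le_rpow (by norm_num) himg_lower.1]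
    refine le_trans ?_ (hcardle B hBcard)
    exact_mod_cast gimg_le_card fun x hx => by simpa using hB x (hTS x hx)
  have hent_upper : ent (outDist W T) ≤ h + 4 * (n * δ) := by
    obtain ⟨B, hBcard, hB⟩ := hblowτ S
    have hTB : 1 - τ ≤ ∑ y ∈ B, outDist W T y := by
      have hT0 : (0 : ℝ) < T.card := by exact_mod_cast hT.card_pos
      refine le_of_mul_le_mul_left ?_ hT0
      rw [card_mul_sum_outDist hT, ← nsmul_eq_mul]
      exact Finset.card_nsmul_le_sum _ _ _ fun x hx => hB x (hTS x hx)
    have h1 := ent_le_of_card_le hp0 hp1 (by positivity) (hcardle B hBcard) hTB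
    rw [Fintype.card_fun, Fintype.card_fin, Nat.cast_pow, Real.logb_pow, ← hℓ] at h1
    nlinarith
  have hent_lower : h - 3 * (n * δ) ≤ ent (outDist W T) := by
    rcases le_or_gt (h - 2 * (n * δ)) 0 with hneg | hpos
    · have := ent_nonneg hp0 hp1
      nlinarith
    set h' := h - 2 * (n * δ) with hh'
    set S' : Finset (Fin n → Y) :=
      Finset.univ.filter fun y => (2 : ℝ) ^ (-h') < outDist W T y with hS'
    have hS'card : (S'.card : ℝ) ≤ 2 ^ h' := by
      have h1 : S'.card * (2 : ℝ) ^ (-h') ≤ 1 := by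
        rw [← nsmul_eq_mul, ← hp1]
        refine (Finset.card_nsmul_le_sum _ _ _ fun y hy => (Finset.mem_filter.1 hy).2.le).trans ?_
        exact Finset.sum_le_sum_of_subset_of_nonneg (Finset.subset_univ _) fun y _ _ => hp0 y
      rwa [Real.rpow_neg (by norm_num), ← div_eq_mul_inv, div_le_iff₀ (by positivity),
        one_mul] at h1
    have hS'σ : ∑ y ∈ S', outDist W T y ≤ σ := by
      by_contra! hlt
      have hT'card := le_card_filter_le_prodWSet hW hT hσ0.le hlt.le
      set T' := T.filter fun x => σ / 2 ≤ prodWSet W x S' with hT'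
      have hT'T : T' ⊆ T := Finset.filter_subset _ _
      have hT0 : (0 : ℝ) < T.card := by exact_mod_cast hT.card_pos
      have hT'ne : T'.Nonempty := by
        rw [← Finset.card_pos]
        exact_mod_cast (mul_pos (half_pos hσ0) hT0).trans_le hT'card
      have h1 := hsub A T' S S' h hT'ne (hT'T.trans hTA)
        (by
          calc σ / 2 * θ * A.card = σ / 2 * (θ * A.card) := by ring
            _ ≤ σ / 2 * T.card := by gcongr
            _ ≤ T'.card := hT'card)
        hSA (fun x hx => hTS x (hT'T hx)) (fun x hx => (Finset.mem_filter.1 hx).2)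
      have h2 : (2 : ℝ) ^ h ≤ 2 ^ (n * δ + h') := by
        rw [Real.rpow_add (by norm_num)]
        exact h1.trans (by gcongr)
      rw [Real.rpow_le_rpow_left_iff (by norm_num)] at h2
      nlinarith
    have h1 := mul_le_ent hp0 hp1 hpos.le
      (fun y hy => not_lt.1 fun hlt => hy (Finset.mem_filter.2 ⟨Finset.mem_univ _, hlt⟩)) hS'σ
    have h2 : σ * h' ≤ n * δ := by
      calc σ * h' ≤ σ * (n * M) := by
            gcongr
            nlinarith
        _ = n * δ := by rw [← hσM]; ring
    linarith
  rw [abs_le]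
  constructor <;> linarith [himg_lower.2]

/-- The information spectrum of `A`, cut into finitely many slices of width `δ`: every input sees
one of them with non-vanishing probability. -/
lemma exists_spectrum_slices [Nonempty Y] (hW : isChannel W) {δ : ℝ} (hδ : 0 < δ) {K : ℕ}
    (hK : K = ⌊(1 + logb 2 (Fintype.card Y)) / δ⌋₊) (hn : 1 ≤ n) {A : Finset (Fin n → X)}
    (hA : A.Nonempty) :
    ∃ S : Fin (K + 1) → Finset (Fin n → Y),
      (∀ k, ∀ y ∈ S k, outDist W A y ≤ 2 * 2 ^ (-(n * ((k : ℕ) * δ)))) ∧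
      (∀ k, ((S k).card : ℝ) ≤ 2 ^ (n * ((k : ℕ) * δ) + n * δ)) ∧
      ∀ x : Fin n → X, ∃ k, ((K : ℝ) + 1)⁻¹ ≤ prodWSet W x (S k) := by
  have hn0 : (0 : ℝ) < n := by exact_mod_cast hn
  have hn1 : (1 : ℝ) ≤ n := by exact_mod_cast hn
  have hnδ : 0 < n * δ := by positivity
  have hY0 : (0 : ℝ) < Fintype.card Y := by exact_mod_cast Fintype.card_pos (α := Y)
  have hp0 := outDist_nonneg hW A
  set u : ℝ := ((Fintype.card Y : ℝ) ^ n)⁻¹ with hu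
  have hu0 : 0 < u := by positivity
  set q : (Fin n → Y) → ℝ := fun y => outDist W A y + u with hq
  have hq0 : ∀ y, 0 < q y := fun y => add_pos_of_nonneg_of_pos (hp0 y) hu0
  have hq2 : ∑ y, q y = 2 := by
    rw [Finset.sum_add_distrib, sum_outDist hW hA, Finset.sum_const, Finset.card_univ,
      Fintype.card_fun, Fintype.card_fin, nsmul_eq_mul, Nat.cast_pow,
      mul_inv_cancel₀ (by positivity)]
    norm_num
  have hqle : ∀ y, q y ≤ 2 := fun y =>
    (Finset.single_le_sum (fun z _ => (hq0 z).le) (Finset.mem_univ y)).trans_eq hq2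
  have hlog_le : ∀ y, 0 ≤ 1 - logb 2 (q y) := fun y => by
    have : logb 2 (q y) ≤ 1 := by
      rw [Real.logb_le_iff_le_rpow (by norm_num) (hq0 y), Real.rpow_one]
      exact hqle y
    linarith
  have hlog_ge : ∀ y, 1 - logb 2 (q y) ≤ n * (1 + logb 2 (Fintype.card Y)) := fun y => by
    have h1 : logb 2 u ≤ logb 2 (q y) :=
      Real.logb_le_logb_of_le (by norm_num) hu0 (by simp [hq, hp0 y])
    rw [hu, Real.logb_inv, Real.logb_pow] at h1
    linarith
  set κ : (Fin n → Y) → ℕ := fun y => ⌊(1 - logb 2 (q y)) / (n * δ)⌋₊ with hκ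
  have hκK : ∀ y, κ y < K + 1 := fun y => by
    rw [Nat.lt_succ_iff, hK]
    refine Nat.floor_mono ?_
    rw [div_le_div_iff₀ hnδ hδ]
    nlinarith [hlog_ge y]
  have hfloor_le : ∀ y, n * (κ y * δ) ≤ 1 - logb 2 (q y) := fun y => by
    have h := Nat.floor_le (div_nonneg (hlog_le y) hnδ.le)
    rw [le_div_iff₀ hnδ] at h
    calc n * (κ y * δ) = κ y * (n * δ) := by ring
      _ ≤ _ := h
  have hlt_floor : ∀ y, 1 - logb 2 (q y) < n * (κ y * δ) + n * δ := fun y => by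
    have h := Nat.lt_floor_add_one ((1 - logb 2 (q y)) / (n * δ))
    rw [div_lt_iff₀ hnδ] at h
    calc _ < ((κ y : ℝ) + 1) * (n * δ) := h
      _ = _ := by ring
  refine ⟨fun k => Finset.univ.filter fun y => (⟨κ y, hκK y⟩ : Fin (K + 1)) = k, ?_, ?_, ?_⟩
  · rintro k y hy
    obtain rfl := (Finset.mem_filter.1 hy).2
    have h1 : logb 2 (q y) ≤ 1 + -(n * (κ y * δ)) := by linarith [hfloor_le y]
    rw [Real.logb_le_iff_le_rpow (by norm_num) (hq0 y), Real.rpow_add (by norm_num),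
      Real.rpow_one] at h1
    refine le_trans ?_ h1
    simp [hq, hu0.le]
  · intro k
    set S := Finset.univ.filter fun y => (⟨κ y, hκK y⟩ : Fin (K + 1)) = k with hS
    set h : ℝ := n * ((k : ℕ) * δ) + n * δ with hh
    have h1 : ∀ y ∈ S, 2 * 2 ^ (-h) ≤ q y := fun y hy => by
      have hk : κ y = k := congrArg Fin.val (Finset.mem_filter.1 hy).2
      have h2 : 1 + -h ≤ logb 2 (q y) := by
        have := hlt_floor y
        rw [hk] at this
        linarith
      rwa [Real.le_logb_iff_rpow_le (by norm_num) (hq0 y), Real.rpow_add (by norm_num),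
        Real.rpow_one] at h2
    have h2 : (S.card : ℝ) * (2 * 2 ^ (-h)) ≤ 2 := by
      rw [← nsmul_eq_mul]
      refine (Finset.card_nsmul_le_sum _ _ _ h1).trans (le_trans ?_ hq2.le)
      exact Finset.sum_le_sum_of_subset_of_nonneg (Finset.subset_univ _) fun y _ _ => (hq0 y).le
    have h3 : S.card * (2 : ℝ) ^ (-h) ≤ 1 := by linarith
    rwa [Real.rpow_neg (by norm_num), ← div_eq_mul_inv, div_le_iff₀ (by positivity), one_mul] at h3
  · intro x
    have hsum : ∑ k : Fin (K + 1), prodWSet W x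
        (Finset.univ.filter fun y => (⟨κ y, hκK y⟩ : Fin (K + 1)) = k) = 1 := by
      simp only [prodWSet]
      rw [Finset.sum_fiberwise, sum_prodW hW]
    obtain ⟨k, _, hk⟩ := Finset.exists_le_of_sum_le (s := (Finset.univ : Finset (Fin (K + 1))))
      Finset.univ_nonempty
      (f := fun _ => ((K : ℝ) + 1)⁻¹) (g := fun k => prodWSet W x
        (Finset.univ.filter fun y => (⟨κ y, hκK y⟩ : Fin (K + 1)) = k)) (by
        rw [hsum, Finset.sum_const, Finset.card_univ, Fintype.card_fin, nsmul_eq_mul]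
        push_cast
        exact (mul_inv_cancel₀ (by positivity)).le)
    exact ⟨k, hk⟩

end ImageSize

open Filter in
/-- Theorem 1: eventually, every nonempty `A` contains a nonempty
`A'` of almost the same exponential size, on which the image-size characterization
coincides with the entropy characterization for all `D` channels. -/
theorem stmt_12 {X : Type*} [Fintype X] [Nonempty X]
    (D : ℕ) (hD : 1 ≤ D)
    (Y : Fin D → Type*) [∀ i, Fintype (Y i)] [∀ i, Nonempty (Y i)]
    (W : (i : Fin D) → X → Y i → ℝ) (hW : ∀ i, isChannel (W i))
    (η : ℝ) (hη : η ∈ Set.Ioo (0:ℝ) 1)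
    (ε : ℝ) (hε : 0 < ε) :
    ∃ N : ℕ, ∀ n : ℕ, N ≤ n → ∀ A : Finset (Fin n → X), A.Nonempty →
      ∃ A' : Finset (Fin n → X), A' ⊆ A ∧ A'.Nonempty ∧
        (0 ≤ (1 / (n:ℝ)) * Real.logb 2 (A.card) - (1 / (n:ℝ)) * Real.logb 2 (A'.card) ∧
          (1 / (n:ℝ)) * Real.logb 2 (A.card) - (1 / (n:ℝ)) * Real.logb 2 (A'.card) ≤ ε) ∧
        ent (condUnif A') = Real.logb 2 (A'.card) ∧
        ∀ i : Fin D,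
          |(1 / (n:ℝ)) * ent (outDist (W i) A') -
            (1 / (n:ℝ)) * Real.logb 2 (gimg (W i) A' η)| ≤ ε := by
  set δ : ℝ := ε / 5 with hδ
  have hδ0 : 0 < δ := by positivity
  set M : Fin D → ℝ := fun i => 1 + Real.logb 2 (Fintype.card (Y i)) with hM
  have hM0 : ∀ i, 0 < M i := fun i => by
    have : 0 ≤ Real.logb 2 (Fintype.card (Y i)) :=
      Real.logb_nonneg (by norm_num) (by exact_mod_cast Fintype.card_pos (α := Y i))
    simp only [hM]
    linarith
  set K : Fin D → ℕ := fun i => ⌊M i / δ⌋₊ with hK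
  have hKδ : ∀ i, ∀ k : Fin (K i + 1), (k : ℕ) * δ ≤ M i := fun i k => by
    rw [← le_div_iff₀ hδ0]
    exact (Nat.cast_le.2 (Nat.lt_succ_iff.1 k.2)).trans
      (Nat.floor_le (div_nonneg (hM0 i).le hδ0.le))
  set m : ℝ := (Fintype.card (∀ i, Fin (K i + 1)) : ℝ) with hm
  have hm0 : 0 < m := Nat.cast_pos.2 Fintype.card_pos
  have hlarge := eventually_all.2 fun i =>
    eventually_abs_ent_sub_logb_gimg_le (hW i) (c := ((K i : ℝ) + 1)⁻¹) (by positivity)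
      (inv_pos.2 hm0) hδ0 (hM0 i) hη
  obtain ⟨N, hN⟩ := eventually_atTop.1 ((hlarge.and (eventually_le_two_rpow_mul m hε)).and
    (eventually_ge_atTop 1))
  refine ⟨N, fun n hNn A hA => ?_⟩
  obtain ⟨⟨hent, hmn⟩, hn⟩ := hN n hNn
  have hn0 : (0 : ℝ) < n := by exact_mod_cast hn
  choose S hSA hScard hSx using fun i => exists_spectrum_slices (hW i) hδ0 (K := K i) rfl hn hA
  choose κ hκ using fun x i => hSx i x
  obtain ⟨k, -, hk⟩ := Finset.exists_le_card_fiber_of_nsmul_le_card_of_maps_to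
    (s := A) (t := Finset.univ) (f := κ) (b := m⁻¹ * (A.card : ℝ)) (fun x _ => Finset.mem_univ _)
    Finset.univ_nonempty (by
      rw [nsmul_eq_mul, Finset.card_univ, ← hm, mul_inv_cancel_left₀ hm0.ne'])
  set T := A.filter fun x => κ x = k with hT
  have hTA : T ⊆ A := Finset.filter_subset _ _
  have hA0 : (0 : ℝ) < A.card := by exact_mod_cast hA.card_pos
  have hT0 : (0 : ℝ) < T.card := (mul_pos (inv_pos.2 hm0) hA0).trans_le hk
  have hTne : T.Nonempty := Finset.card_pos.1 (by exact_mod_cast hT0)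
  refine ⟨T, hTA, hTne, ⟨?_, ?_⟩, ent_condUnif hTne, fun i => ?_⟩
  · rw [← mul_sub]
    refine mul_nonneg (by positivity) (sub_nonneg.2 ?_)
    exact Real.logb_le_logb_of_le (by norm_num) hT0 (by exact_mod_cast Finset.card_le_card hTA)
  · rw [← mul_sub, one_div_mul_eq_div, div_le_iff₀ hn0, ← Real.logb_div hA0.ne' hT0.ne',
      Real.logb_le_iff_le_rpow (by norm_num) (div_pos hA0 hT0), mul_comm ε]
    refine le_trans ?_ hmn
    rw [div_le_iff₀ hT0]
    rwa [inv_mul_le_iff₀ hm0] at hk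
  · have h := hent i A T (S i (k i)) (n * ((k i : ℕ) * δ)) hTne hTA hk (by positivity)
      (mul_le_mul_of_nonneg_left (hKδ i (k i)) hn0.le) (hSA i (k i)) (hScard i (k i))
      fun x hx => by
        have hx2 := (Finset.mem_filter.1 hx).2
        rw [← hx2]
        exact hκ x i
    rw [← mul_sub, abs_mul, abs_of_pos (by positivity), one_div_mul_eq_div, div_le_iff₀ hn0]
    refine h.trans_eq ?_
    rw [hδ]
    ring
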